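/- Let ρ ≥ 2 be an integer, let s₀ > 0 be a positive real number, and let s₁, …, s_ρ ∈ ℂ be arbitrary complex numbers. Then there exists a finitely atomic (positive) measure μ on the Borel sets of ℂ, whose support contains at least ρ distinct points, such that ∫_ℂ zᵏ dμ(z) = s_k for every k = 0, 1, …, ρ. -/

import Mathlib

open MeasureTheory

noncomputable section

/-- The integral against a finitely atomic measure is the weighted sum over its atoms. -/
lemma integral_sum_smul_dirac {N : ℕ} (u : Fin N → ℂ) (m : Fin N → ℝ) (hm : ∀ j, 0 ≤ m j)
    (f : ℂ → ℂ) :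
    ∫ z, f z ∂(∑ j : Fin N, ENNReal.ofReal (m j) • Measure.dirac (u j)) =
      ∑ j : Fin N, (m j : ℂ) * f (u j) := by
  rw [integral_finsetSum_measure]
  · refine Finset.sum_congr rfl fun j _ => ?_
    rw [integral_smul_measure, integral_dirac, ENNReal.toReal_ofReal (hm j), Complex.real_smul]
  · intro j _
    exact (integrable_dirac (by simp)).smul_measure ENNReal.ofReal_ne_top

/-- Orthogonality relation for the powers of a primitive root of unity. -/
lemma IsPrimitiveRoot.sum_fin_pow_pow {ω : ℂ} {N : ℕ} (hω : IsPrimitiveRoot ω N) (e : ℕ) :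
    ∑ j : Fin N, (ω ^ (j : ℕ)) ^ e = if N ∣ e then (N : ℂ) else 0 := by
  simp_rw [pow_right_comm ω _ e]
  rw [Fin.sum_univ_eq_sum_range (fun j => (ω ^ e) ^ j) N]
  split_ifs with h
  · simp [(hω.pow_eq_one_iff_dvd e).2 h]
  · have h1 : ω ^ e ≠ 1 := fun h' => h ((hω.pow_eq_one_iff_dvd e).1 h')
    rw [geom_sum_eq h1, ← pow_mul, mul_comm e N, pow_mul, hω.pow_eq_one]
    simp

/-- The value at `x` of the real trigonometric polynomial with constant term `c`
and coefficients `a l`, for `1 ≤ l ≤ ρ`. -/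
def trigPoly (ρ : ℕ) (c : ℝ) (a : ℕ → ℂ) (x : ℂ) : ℝ :=
  c + 2 * (∑ l ∈ Finset.Icc 1 ρ, a l * starRingEnd ℂ x ^ l).re

lemma trigPoly_pos {ρ : ℕ} {c : ℝ} {a : ℕ → ℂ} {x : ℂ} (hx : ‖x‖ = 1)
    (h : 2 * ∑ l ∈ Finset.Icc 1 ρ, ‖a l‖ < c) : 0 < trigPoly ρ c a x := by
  have h1 : ‖∑ l ∈ Finset.Icc 1 ρ, a l * starRingEnd ℂ x ^ l‖ ≤
      ∑ l ∈ Finset.Icc 1 ρ, ‖a l‖ :=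
    (norm_sum_le _ _).trans (Finset.sum_le_sum fun l _ => by simp [hx])
  have h2 := (abs_le.1 (Complex.abs_re_le_norm
    (∑ l ∈ Finset.Icc 1 ρ, a l * starRingEnd ℂ x ^ l))).1
  unfold trigPoly
  linarith

/-- On `N`-th roots of unity, a trigonometric polynomial of degree at most `N`
is an ordinary polynomial. -/
lemma trigPoly_eq {ρ N : ℕ} (hN : ρ ≤ N) (c : ℝ) (a : ℕ → ℂ) {x : ℂ} (hx : ‖x‖ = 1)
    (hxN : x ^ N = 1) :
    (trigPoly ρ c a x : ℂ) =
      c + ∑ l ∈ Finset.Icc 1 ρ, (a l * x ^ (N - l) + starRingEnd ℂ (a l) * x ^ l) := by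
  have hconj : ∀ l ∈ Finset.Icc 1 ρ, starRingEnd ℂ x ^ l = x ^ (N - l) := by
    intro l hl
    have hx0 : x ≠ 0 := by
      rintro rfl
      simp at hx
    have h1 : starRingEnd ℂ x * x = 1 := by
      rw [mul_comm, Complex.mul_conj']
      simp [hx]
    have h2 : x ^ (N - l) * x ^ l = 1 := by
      rw [← pow_add, Nat.sub_add_cancel ((Finset.mem_Icc.1 hl).2.trans hN), hxN]
    apply mul_right_cancel₀ (pow_ne_zero l hx0)
    rw [h2, ← mul_pow, h1, one_pow]
  unfold trigPoly
  push_cast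
  rw [← Complex.ofReal_ofNat 2, ← Complex.ofReal_mul, ← Complex.add_conj, map_sum,
    ← Finset.sum_add_distrib]
  congr 1
  refine Finset.sum_congr rfl fun l hl => ?_
  rw [map_mul, map_pow, Complex.conj_conj, hconj l hl]

/-- The moments of a trigonometric polynomial over the roots of unity are its coefficients. -/
lemma sum_trigPoly_mul_pow {ρ N : ℕ} (hN : 2 * ρ < N) {ω : ℂ} (hω : IsPrimitiveRoot ω N)
    (c : ℝ) (a : ℕ → ℂ) {k : ℕ} (hk : k ≤ ρ) :
    ∑ j : Fin N, (trigPoly ρ c a (ω ^ (j : ℕ)) : ℂ) * (ω ^ (j : ℕ)) ^ k =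
      N * if k = 0 then (c : ℂ) else a k := by
  have hnorm : ‖ω‖ = 1 := hω.norm'_eq_one (by omega)
  have hexp : ∀ j : Fin N, (trigPoly ρ c a (ω ^ (j : ℕ)) : ℂ) * (ω ^ (j : ℕ)) ^ k =
      c * (ω ^ (j : ℕ)) ^ k + ∑ l ∈ Finset.Icc 1 ρ, (a l * (ω ^ (j : ℕ)) ^ (N - l + k) +
        starRingEnd ℂ (a l) * (ω ^ (j : ℕ)) ^ (l + k)) := by
    intro j
    rw [trigPoly_eq (N := N) (by omega) c a (by simp [hnorm])
      (by rw [pow_right_comm, hω.pow_eq_one, one_pow]), add_mul, Finset.sum_mul]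
    congr 1
    refine Finset.sum_congr rfl fun l _ => ?_
    rw [pow_add, pow_add]
    ring
  simp_rw [hexp]
  rw [Finset.sum_add_distrib, Finset.sum_comm, ← Finset.mul_sum]
  simp_rw [Finset.sum_add_distrib, ← Finset.mul_sum, hω.sum_fin_pow_pow]
  have hk0 : N ∣ k ↔ k = 0 :=
    ⟨fun h => Nat.eq_zero_of_dvd_of_lt h (by omega), by rintro rfl; simp⟩
  have hneg : ∑ l ∈ Finset.Icc 1 ρ, starRingEnd ℂ (a l) * (if N ∣ l + k then (N : ℂ) else 0)
      = 0 := by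
    refine Finset.sum_eq_zero fun l hl => ?_
    rw [Finset.mem_Icc] at hl
    rw [if_neg (fun h => absurd (Nat.le_of_dvd (by omega) h) (by omega)), mul_zero]
  have hpos : ∑ l ∈ Finset.Icc 1 ρ, a l * (if N ∣ N - l + k then (N : ℂ) else 0) =
      ∑ l ∈ Finset.Icc 1 ρ, if k = l then a l * N else 0 := by
    refine Finset.sum_congr rfl fun l hl => ?_
    rw [Finset.mem_Icc] at hl
    have : N ∣ N - l + k ↔ k = l := by
      constructor
      · rintro ⟨q, hq⟩
        have hq1 : q = 1 := by
          rcases q with _ | _ | q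
          · omega
          · rfl
          · have : N * 2 ≤ N * (q + 1 + 1) := Nat.mul_le_mul_left _ (by omega)
            omega
        subst hq1
        omega
      · rintro rfl
        rw [Nat.sub_add_cancel (by omega)]
    simp only [this, mul_ite, mul_zero]
  rw [hneg, hpos, Finset.sum_ite_eq]
  simp only [hk0, Finset.mem_Icc]
  by_cases h : k = 0
  · simp [h, mul_comm]
  · simp [h, hk, Nat.one_le_iff_ne_zero, mul_comm]

/-- Rescaling by a large radius makes the coefficients of a moment sequence small. -/
lemma exists_one_le_sum_norm_div_pow_lt (ρ : ℕ) (s : ℕ → ℂ) {c : ℝ} (hc : 0 < c) :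
    ∃ R : ℝ, 1 ≤ R ∧ 2 * ∑ l ∈ Finset.Icc 1 ρ, ‖s l / (R : ℂ) ^ l‖ < c := by
  set S := ∑ l ∈ Finset.Icc 1 ρ, ‖s l‖ with hS
  have hS0 : 0 ≤ S := Finset.sum_nonneg fun _ _ => norm_nonneg _
  have hR : 1 ≤ 1 + 2 * S / c := le_add_of_nonneg_right (by positivity)
  refine ⟨1 + 2 * S / c, hR, ?_⟩
  set R := 1 + 2 * S / c with hRdef
  have hR0 : 0 < R := by linarith
  have hle : ∑ l ∈ Finset.Icc 1 ρ, ‖s l / (R : ℂ) ^ l‖ ≤ S / R := by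
    rw [hS, Finset.sum_div]
    refine Finset.sum_le_sum fun l hl => ?_
    rw [norm_div, norm_pow, Complex.norm_real, Real.norm_of_nonneg hR0.le]
    gcongr
    exact le_self_pow₀ hR (by have := (Finset.mem_Icc.1 hl).1; omega)
  have hlt : 2 * (S / R) < c := by
    rw [← mul_div_assoc, div_lt_iff₀ hR0, hRdef, mul_add, mul_div_cancel₀ _ hc.ne']
    linarith
  linarith

/-- For every `ρ ≥ 2`, `s₀ > 0` and arbitrary complex `s₁, …, s_ρ`, the
truncated complex moment problem has a finitely atomic solution whose support
contains at least `ρ` distinct points. -/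
theorem truncated_moment_problem_solvable
    (ρ : ℕ) (hρ : 2 ≤ ρ) (s₀ : ℝ) (hs₀ : 0 < s₀) (s : ℕ → ℂ) :
    ∃ (μ : Measure ℂ) (N : ℕ) (u : Fin N → ℂ) (m : Fin N → ℝ),
      ρ ≤ N ∧ Function.Injective u ∧ (∀ j, 0 < m j) ∧
      μ = ∑ j : Fin N, ENNReal.ofReal (m j) • Measure.dirac (u j) ∧
      (∫ z : ℂ, (1 : ℂ) ∂μ) = (s₀ : ℂ) ∧
      ∀ k : ℕ, 1 ≤ k → k ≤ ρ → ∫ z : ℂ, z ^ k ∂μ = s k := by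
  obtain ⟨R, hR, hsmall⟩ := exists_one_le_sum_norm_div_pow_lt ρ s hs₀
  have hRC : (R : ℂ) ≠ 0 := Complex.ofReal_ne_zero.2 (by linarith)
  obtain ⟨N, hN⟩ : ∃ N, 2 * ρ < N := ⟨2 * ρ + 1, by omega⟩
  have hN0 : N ≠ 0 := by omega
  have hNC : (N : ℂ) ≠ 0 := Nat.cast_ne_zero.2 hN0
  set ω : ℂ := Complex.exp (2 * Real.pi * Complex.I / N)
  have hω : IsPrimitiveRoot ω N := Complex.isPrimitiveRoot_exp N hN0
  set a : ℕ → ℂ := fun l => s l / (R : ℂ) ^ l with ha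
  set m : Fin N → ℝ := fun j => trigPoly ρ s₀ a (ω ^ (j : ℕ)) / N with hm
  have hmpos : ∀ j, 0 < m j := fun j =>
    div_pos (trigPoly_pos (by simp [hω.norm'_eq_one hN0]) hsmall)
      (Nat.cast_pos.2 (Nat.pos_of_ne_zero hN0))
  have hmoment : ∀ k ≤ ρ, ∑ j : Fin N, (m j : ℂ) * (R * ω ^ (j : ℕ)) ^ k =
      R ^ k * if k = 0 then (s₀ : ℂ) else a k := by
    intro k hk
    have h := sum_trigPoly_mul_pow hN hω s₀ a hk
    have hfactor : ∑ j : Fin N, (m j : ℂ) * (R * ω ^ (j : ℕ)) ^ k = R ^ k / N *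
        ∑ j : Fin N, (trigPoly ρ s₀ a (ω ^ (j : ℕ)) : ℂ) * (ω ^ (j : ℕ)) ^ k := by
      rw [Finset.mul_sum]
      refine Finset.sum_congr rfl fun j _ => ?_
      simp only [hm]
      push_cast
      ring
    rw [hfactor, h, ← mul_assoc, div_mul_cancel₀ _ hNC]
  refine ⟨_, N, fun j => R * ω ^ (j : ℕ), m, by omega, ?_, hmpos, rfl, ?_, ?_⟩
  · intro i j hij
    exact Fin.ext (hω.pow_inj i.2 j.2 (mul_left_cancel₀ hRC hij))
  · rw [integral_sum_smul_dirac _ _ (fun j => (hmpos j).le)]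
    simpa using hmoment 0 (Nat.zero_le ρ)
  · intro k hk1 hk
    rw [integral_sum_smul_dirac _ _ (fun j => (hmpos j).le), hmoment k hk,
      if_neg (Nat.one_le_iff_ne_zero.1 hk1)]
    exact mul_div_cancel₀ _ (pow_ne_zero k hRC)
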